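/- arXiv:math/9312209 — 3 statements merged into one kernel-verified Lean document; each statement's English description precedes it below -/
import Mathlib

section
/- Let f : [0,1] → ℝ be a bounded function such that the one-sided limits lim_{y↑x} f(y) and lim_{y↓x} f(y) exist at every point x where they make sense. Then f ∈ SD([0,1]); in particular f is a difference of bounded semicontinuous functions on [0,1]. -/
open Filter Topology Set

noncomputable section

/-- A real-valued function is bounded. -/
def BddFun {X : Type*} (f : X → ℝ) : Prop := ∃ C, ∀ x, |f x| ≤ C

/-- `f ∈ DBSC(X)`: `f` is a difference of bounded lower semicontinuous functions. -/
def MemDBSC {X : Type*} [TopologicalSpace X] (f : X → ℝ) : Prop :=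
  ∃ u v : X → ℝ, BddFun u ∧ BddFun v ∧ LowerSemicontinuous u ∧ LowerSemicontinuous v ∧
    f = u - v

/-- The D-norm of `f`. -/
def DNorm {X : Type*} [TopologicalSpace X] (f : X → ℝ) : ℝ :=
  sInf {c | ∃ φ : ℕ → X → ℝ, (∀ j, Continuous (φ j)) ∧ (∀ x, Summable fun j => |φ j x|) ∧
    (∀ x, ∑' j, φ j x = f x) ∧ (∀ x, ∑' j, |φ j x| ≤ c)}

/-- The sup-norm of `f`. -/
def supNorm {X : Type*} (f : X → ℝ) : ℝ := ⨆ x, |f x|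

/-- A simple D-function: a D-function taking finitely many values. -/
def SimpleD {X : Type*} [TopologicalSpace X] (f : X → ℝ) : Prop :=
  MemDBSC f ∧ (Set.range f).Finite

/-- `f ∈ SD(X)`: `f` is a strong D-function. -/
def MemSD {X : Type*} [TopologicalSpace X] (f : X → ℝ) : Prop :=
  ∃ φ : ℕ → X → ℝ, (∀ n, SimpleD (φ n)) ∧
    Tendsto (fun n => DNorm (f - φ n)) atTop (𝓝 0)

/-- `f ∈ B_{1/2}(X)`: `f` is a uniform limit of D-functions. -/
def MemBHalf {X : Type*} [TopologicalSpace X] (f : X → ℝ) : Prop :=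
  ∃ g : ℕ → X → ℝ, (∀ n, MemDBSC (g n)) ∧ TendstoUniformly g f atTop

/-- The upper semicontinuous envelope `Uf`. -/
def uEnv {X : Type*} [TopologicalSpace X] (f : X → ℝ) (x : X) : ℝ :=
  sInf {c | ∃ V : Set X, IsOpen V ∧ x ∈ V ∧ sSup (f '' V) = c}

/-- The lower oscillation of `f` at `x`. -/
def losc {X : Type*} [TopologicalSpace X] (f : X → ℝ) (x : X) : ℝ :=
  sInf {c | ∃ V : Set X, IsOpen V ∧ x ∈ V ∧ sSup ((fun y => |f y - f x|) '' V) = c}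

/-- The oscillation of `f`: `osc f = U (losc f)`. -/
def osc {X : Type*} [TopologicalSpace X] (f : X → ℝ) : X → ℝ := uEnv (losc f)

/-- The oscillation sets `os_n(f, ε)`. -/
def osSet {X : Type*} [TopologicalSpace X] (f : X → ℝ) (ε : ℝ) : ℕ → Set X
  | 0 => Set.univ
  | n + 1 => {x | ∃ h : x ∈ osSet f ε n, ε ≤ osc ((osSet f ε n).restrict f) ⟨x, h⟩}

/-- The `ε`-oscillation index `i(f, ε) = sup {n : os_n(f,ε) ≠ ∅}`. -/
def oscIndex {X : Type*} [TopologicalSpace X] (f : X → ℝ) (ε : ℝ) : ℕ∞ :=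
  ⨆ (m : ℕ) (_ : (osSet f ε m).Nonempty), (m : ℕ∞)

/-- `f` has finite Baire index. -/
def FiniteBaireIndex {X : Type*} [TopologicalSpace X] (f : X → ℝ) : Prop :=
  ∃ n : ℕ, ∀ ε > 0, osSet f ε n = ∅

/-- The Baire index `i(f) = sup_{ε > 0} i(f, ε)`. -/
def baireIndex {X : Type*} [TopologicalSpace X] (f : X → ℝ) : ℕ∞ :=
  ⨆ (ε : ℝ) (_ : 0 < ε), oscIndex f ε

open scoped ENNReal

/-- `f` is the pointwise sum of a series of continuous functions whose absolute values sum to at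
most `c` everywhere; the D-norm of `f` is the infimum of these `c`. -/
def HasDBound {X : Type*} [TopologicalSpace X] (f : X → ℝ) (c : ℝ) : Prop :=
  ∃ φ : ℕ → X → ℝ, (∀ j, Continuous (φ j)) ∧ (∀ x, Summable fun j => |φ j x|) ∧
    (∀ x, ∑' j, φ j x = f x) ∧ (∀ x, ∑' j, |φ j x| ≤ c)

/-- `f` takes finitely many values and has finitely many points of discontinuity. -/
def IsStep {X : Type*} [TopologicalSpace X] (f : X → ℝ) : Prop :=
  (Set.range f).Finite ∧ {x | ¬ ContinuousAt f x}.Finite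

section TopologicalSpace

variable {X : Type*} [TopologicalSpace X]

theorem HasDBound.dNorm_le [Nonempty X] {f : X → ℝ} {c : ℝ} (h : HasDBound f c) :
    DNorm f ≤ c := by
  refine csInf_le ⟨0, ?_⟩ h
  rintro c ⟨φ, -, -, -, h⟩
  obtain ⟨x⟩ := ‹Nonempty X›
  exact (tsum_nonneg fun _ => abs_nonneg _).trans (h x)

theorem dNorm_nonneg [Nonempty X] (f : X → ℝ) : 0 ≤ DNorm f := by
  refine Real.sInf_nonneg ?_
  rintro c ⟨φ, -, -, -, h⟩
  obtain ⟨x⟩ := ‹Nonempty X›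
  exact (tsum_nonneg fun _ => abs_nonneg _).trans (h x)

theorem lowerSemicontinuous_tsum_of_nonneg {φ : ℕ → X → ℝ} (hc : ∀ j, Continuous (φ j))
    (h0 : ∀ j x, 0 ≤ φ j x) (hs : ∀ x, Summable fun j => φ j x) :
    LowerSemicontinuous fun x => ∑' j, φ j x := by
  intro x y hy
  obtain ⟨n, hn⟩ := ((hs x).hasSum.tendsto_sum_nat.eventually (lt_mem_nhds hy)).exists
  have hcont : Continuous fun z => ∑ j ∈ Finset.range n, φ j z :=
    continuous_finsetSum _ fun j _ => hc j
  filter_upwards [hcont.continuousAt.eventually (lt_mem_nhds hn)] with z hz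
  exact hz.trans_le ((hs z).sum_le_tsum _ fun j _ => h0 j z)

theorem HasDBound.memDBSC {f : X → ℝ} {c : ℝ} (h : HasDBound f c) : MemDBSC f := by
  obtain ⟨φ, hc, hs, hf, hle⟩ := h
  have hp : ∀ x, Summable fun j => max (φ j x) 0 := fun x =>
    (hs x).of_nonneg_of_le (fun j => le_max_right _ _)
      fun j => max_le (le_abs_self _) (abs_nonneg _)
  have hn : ∀ x, Summable fun j => max (-φ j x) 0 := fun x =>
    (hs x).of_nonneg_of_le (fun j => le_max_right _ _)
      fun j => max_le (neg_le_abs _) (abs_nonneg _)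
  refine ⟨fun x => ∑' j, max (φ j x) 0, fun x => ∑' j, max (-φ j x) 0, ⟨c, fun x => ?_⟩,
    ⟨c, fun x => ?_⟩, ?_, ?_, ?_⟩
  · rw [abs_of_nonneg (tsum_nonneg fun j => le_max_right _ _)]
    exact ((hp x).tsum_le_tsum (fun j => max_le (le_abs_self _) (abs_nonneg _)) (hs x)).trans
      (hle x)
  · rw [abs_of_nonneg (tsum_nonneg fun j => le_max_right _ _)]
    exact ((hn x).tsum_le_tsum (fun j => max_le (neg_le_abs _) (abs_nonneg _)) (hs x)).trans
      (hle x)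
  · exact lowerSemicontinuous_tsum_of_nonneg (fun j => (hc j).max continuous_const)
      (fun j x => le_max_right _ _) hp
  · exact lowerSemicontinuous_tsum_of_nonneg (fun j => (hc j).neg.max continuous_const)
      (fun j x => le_max_right _ _) hn
  · funext x
    rw [Pi.sub_apply, ← (hp x).tsum_sub (hn x), ← hf x]
    congr 1 with j
    rcases le_total (φ j x) 0 with h | h
    · rw [max_eq_right h, max_eq_left (by linarith)]; ring
    · rw [max_eq_left h, max_eq_right (by linarith)]; ring

theorem MemDBSC.add {f g : X → ℝ} (hf : MemDBSC f) (hg : MemDBSC g) : MemDBSC (f + g) := by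
  obtain ⟨u, v, ⟨a, ha⟩, ⟨b, hb⟩, hu, hv, rfl⟩ := hf
  obtain ⟨u', v', ⟨a', ha'⟩, ⟨b', hb'⟩, hu', hv', rfl⟩ := hg
  exact ⟨u + u', v + v', ⟨a + a', fun x => (abs_add_le _ _).trans (add_le_add (ha x) (ha' x))⟩,
    ⟨b + b', fun x => (abs_add_le _ _).trans (add_le_add (hb x) (hb' x))⟩,
    hu.add hu', hv.add hv', by abel⟩

theorem HasDBound.of_hasSum {s : ℕ → X → ℝ} {c : ℕ → ℝ} {f : X → ℝ} {C : ℝ}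
    (h : ∀ k, HasDBound (s k) (c k)) (hc : HasSum c C) (hf : ∀ x, HasSum (fun k => s k x) (f x)) :
    HasDBound f C := by
  choose φ hφ hs hsum hle using h
  have hfib : ∀ x, Summable fun k => ∑' j, |φ k j x| := fun x =>
    hc.summable.of_nonneg_of_le (fun k => tsum_nonneg fun j => abs_nonneg _) fun k => hle k x
  have habs : ∀ x, Summable fun p : ℕ × ℕ => |φ p.1 p.2 x| := fun x =>
    (summable_prod_of_nonneg fun p => abs_nonneg (φ p.1 p.2 x)).2 ⟨fun k => hs k x, hfib x⟩
  refine ⟨fun m => φ (Nat.pairEquiv.symm m).1 (Nat.pairEquiv.symm m).2, fun m => hφ _ _, fun x => ?_, fun x => ?_,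
    fun x => ?_⟩
  · exact (habs x).comp_injective Nat.pairEquiv.symm.injective
  · refine (Nat.pairEquiv.symm.tsum_eq fun p : ℕ × ℕ => φ p.1 p.2 x).trans ?_
    rw [(habs x).of_abs.tsum_prod, ← (hf x).tsum_eq]
    exact tsum_congr fun k => hsum k x
  · refine (Nat.pairEquiv.symm.tsum_eq fun p : ℕ × ℕ => |φ p.1 p.2 x|).trans_le ?_
    rw [(habs x).tsum_prod, ← hc.tsum_eq]
    exact (hfib x).tsum_le_tsum (fun k => hle k x) hc.summable

theorem IsStep.sub {f g : X → ℝ} (hf : IsStep f) (hg : IsStep g) : IsStep (f - g) := by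
  refine ⟨(hf.1.image2 (· - ·) hg.1).subset ?_, (hf.2.union hg.2).subset ?_⟩
  · rintro _ ⟨x, rfl⟩
    exact ⟨f x, ⟨x, rfl⟩, g x, ⟨x, rfl⟩, rfl⟩
  · intro x hx
    by_contra h
    simp only [mem_union, mem_ofPred_eq, not_or, not_not] at h
    exact hx (h.1.sub h.2)

theorem IsStep.exists_abs_le {f : X → ℝ} (hf : IsStep f) : ∃ c, ∀ x, |f x| ≤ c := by
  obtain ⟨c, hc⟩ := (hf.1.image abs).bddAbove
  exact ⟨c, fun x => hc ⟨f x, ⟨x, rfl⟩, rfl⟩⟩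

open Classical in
theorem IsStep.piecewise {f g : X → ℝ} (hf : IsStep f) (hg : IsStep g) {A : Set X}
    (hA : (frontier A).Finite) : IsStep (A.piecewise f g) := by
  refine ⟨(hf.1.union hg.1).subset ?_, ((hf.2.union hg.2).union hA).subset ?_⟩
  · rintro _ ⟨x, rfl⟩
    by_cases hx : x ∈ A
    · rw [piecewise_eq_of_mem _ _ _ hx]; exact Or.inl ⟨x, rfl⟩
    · rw [piecewise_eq_of_notMem _ _ _ hx]; exact Or.inr ⟨x, rfl⟩
  · intro x hx
    by_contra h
    simp only [mem_union, mem_ofPred_eq, not_or, not_not] at h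
    obtain ⟨⟨h1, h2⟩, h3⟩ := h
    apply hx
    by_cases hxA : x ∈ closure A
    · have : x ∈ interior A := by
        by_contra hi
        exact h3 ⟨hxA, hi⟩
      refine h1.congr ?_
      filter_upwards [mem_interior_iff_mem_nhds.1 this] with y hy
      rw [piecewise_eq_of_mem _ _ _ hy]
    · refine h2.congr ?_
      filter_upwards [isClosed_closure.isOpen_compl.mem_nhds hxA] with y hy
      rw [piecewise_eq_of_notMem _ _ _ fun h => hy (subset_closure h)]

theorem hasSum_sub_of_tendsto {a : ℕ → ℝ} {l : ℝ} (ha : Tendsto a atTop (𝓝 l))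
    (hs : Summable fun n => a (n + 1) - a n) : HasSum (fun n => a (n + 1) - a n) (l - a 0) := by
  rw [hs.hasSum_iff_tendsto_nat]
  simpa only [Finset.sum_range_sub] using ha.sub_const (a 0)

end TopologicalSpace

section MetricSpace

variable {X : Type*} [MetricSpace X]

/-- The cutoffs `min 1 (n * d(x, T))` increase to the indicator function of the complement of a
closed set `T`. -/
def cutoff (T : Set X) (n : ℕ) (x : X) : ℝ := min 1 (n * Metric.infDist x T)

theorem continuous_cutoff (T : Set X) (n : ℕ) : Continuous (cutoff T n) :=
  continuous_const.min (continuous_const.mul (Metric.continuous_infDist_pt T))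

theorem cutoff_nonneg (T : Set X) (n : ℕ) (x : X) : 0 ≤ cutoff T n x :=
  le_min zero_le_one (mul_nonneg n.cast_nonneg Metric.infDist_nonneg)

theorem cutoff_of_mem {T : Set X} {x : X} (hx : x ∈ T) (n : ℕ) : cutoff T n x = 0 := by
  simp [cutoff, Metric.infDist_zero_of_mem hx]

theorem cutoff_le_succ (T : Set X) (n : ℕ) (x : X) : cutoff T n x ≤ cutoff T (n + 1) x := by
  refine min_le_min le_rfl (mul_le_mul_of_nonneg_right ?_ Metric.infDist_nonneg)
  exact_mod_cast n.le_succ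

theorem tendsto_cutoff {T : Set X} (hT : IsClosed T) (hne : T.Nonempty) {x : X} (hx : x ∉ T) :
    Tendsto (fun n => cutoff T n x) atTop (𝓝 1) := by
  have hpos := (hT.notMem_iff_infDist_pos hne).1 hx
  refine tendsto_const_nhds.congr' ?_
  filter_upwards [(tendsto_natCast_atTop_atTop.atTop_mul_const hpos).eventually_ge_atTop 1]
    with n hn
  exact (min_eq_left hn).symm

theorem continuous_cutoff_mul {T : Set X} {g : X → ℝ} {c : ℝ}
    (hg : ∀ x ∉ T, ContinuousAt g x) (hb : ∀ x, |g x| ≤ c) (n : ℕ) :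
    Continuous fun x => cutoff T n x * g x := by
  refine continuous_iff_continuousAt.2 fun x => ?_
  by_cases hx : x ∈ T
  · have h0 : Tendsto (cutoff T n) (𝓝 x) (𝓝 0) := by
      simpa only [cutoff_of_mem hx n] using (continuous_cutoff T n).tendsto x
    rw [ContinuousAt, cutoff_of_mem hx, zero_mul]
    refine squeeze_zero_norm (fun y => ?_) (by simpa only [zero_mul] using h0.mul_const c)
    rw [norm_mul, Real.norm_eq_abs, Real.norm_eq_abs, abs_of_nonneg (cutoff_nonneg T n y)]
    exact mul_le_mul_of_nonneg_left (hb y) (cutoff_nonneg T n y)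
  · exact (continuous_cutoff T n).continuousAt.mul (hg x hx)

theorem HasDBound.of_continuousAt_off_closed {T : Set X} (hT : IsClosed T) (hne : T.Nonempty)
    {g : X → ℝ} {c : ℝ} (hg : ∀ x ∉ T, ContinuousAt g x) (hb : ∀ x, |g x| ≤ c)
    (h0 : ∀ x ∈ T, g x = 0) : HasDBound g c := by
  have key : ∀ x (a : ℝ), (x ∈ T → a = 0) →
      HasSum (fun n => (cutoff T (n + 1) x - cutoff T n x) * a) a := by
    intro x a ha
    by_cases hx : x ∈ T
    · simp [ha hx]
    · have : HasSum (fun n => cutoff T (n + 1) x - cutoff T n x) 1 := by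
        rw [hasSum_iff_tendsto_nat_of_nonneg fun n => sub_nonneg.2 (cutoff_le_succ T n x)]
        simp only [Finset.sum_range_sub (fun n => cutoff T n x)]
        simpa [cutoff] using tendsto_cutoff hT hne hx
      simpa using this.mul_right a
  have habs : ∀ x, HasSum (fun n => |cutoff T (n + 1) x * g x - cutoff T n x * g x|) |g x| := by
    intro x
    convert key x |g x| (fun hx => by simp [h0 x hx]) using 2 with n
    rw [← sub_mul, abs_mul, abs_of_nonneg (sub_nonneg.2 (cutoff_le_succ T n x))]
  refine ⟨fun n x => cutoff T (n + 1) x * g x - cutoff T n x * g x,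
    fun n => (continuous_cutoff_mul hg hb _).sub (continuous_cutoff_mul hg hb _),
    fun x => (habs x).summable, fun x => ?_, fun x => (habs x).tsum_eq.trans_le (hb x)⟩
  simp only [← sub_mul]
  exact (key x (g x) (h0 x)).tsum_eq

theorem HasDBound.of_continuous {h : X → ℝ} {c : ℝ} (hh : Continuous h) (hb : ∀ x, |h x| ≤ c) :
    HasDBound h c := by
  have key : ∀ a : ℝ, HasSum (fun n : ℕ => if n = 0 then a else 0) a := fun a =>
    hasSum_ite_eq 0 a
  have habs : ∀ x, HasSum (fun n : ℕ => |if n = 0 then h x else 0|) |h x| := fun x => by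
    simpa only [apply_ite abs, abs_zero] using key |h x|
  refine ⟨fun n x => if n = 0 then h x else 0, fun n => ?_, fun x => (habs x).summable,
    fun x => (key _).tsum_eq, fun x => (habs x).tsum_eq.trans_le (hb x)⟩
  by_cases hn : n = 0
  · simpa [hn] using hh
  · simpa [hn] using continuous_const

theorem HasDBound.add {f g : X → ℝ} {a b : ℝ} (hf : HasDBound f a) (hg : HasDBound g b) :
    HasDBound (f + g) (a + b) := by
  have h0 : HasDBound (0 : X → ℝ) 0 := .of_continuous continuous_const (by simp)
  have key : ∀ u v : ℝ,
      HasSum (fun n : ℕ => if n = 0 then u else if n = 1 then v else 0) (u + v) := by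
    intro u v
    have := hasSum_sum_of_ne_finset_zero (L := .unconditional ℕ) (s := Finset.range 2)
      (f := fun n : ℕ => if n = 0 then u else if n = 1 then v else 0)
      (fun n hn => by
        rw [Finset.mem_range] at hn
        rw [if_neg (by omega), if_neg (by omega)])
    simpa [Finset.sum_range_succ] using this
  refine .of_hasSum (s := fun n => if n = 0 then f else if n = 1 then g else 0)
    (c := fun n => if n = 0 then a else if n = 1 then b else 0) (fun n => ?_) (key a b)
    fun x => ?_
  · split_ifs
    exacts [hf, hg, h0]
  · rw [Pi.add_apply]
    convert key (f x) (g x) using 1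
    funext n
    split_ifs <;> rfl

theorem HasDBound.of_finite_discontinuities {f : X → ℝ} {c : ℝ}
    (hf : {x | ¬ ContinuousAt f x}.Finite) (hb : ∀ x, |f x| ≤ c) : HasDBound f (3 * c) := by
  rcases isEmpty_or_nonempty X with hX | ⟨⟨x₀⟩⟩
  · exact ⟨0, fun _ => continuous_const, fun x => isEmptyElim x, fun x => isEmptyElim x,
      fun x => isEmptyElim x⟩
  have hc : 0 ≤ c := (abs_nonneg _).trans (hb x₀)
  set T := insert x₀ {x | ¬ ContinuousAt f x}
  have hfin : T.Finite := hf.insert x₀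
  have hT : IsClosed T := hfin.isClosed
  have : Finite T := hfin
  obtain ⟨h, hmem, heq⟩ := ContinuousMap.exists_restrict_eq_forall_mem_of_closed
    (⟨fun x : T => f x, continuous_of_discreteTopology⟩ : C(T, ℝ)) (t := Icc (-c) c)
    (fun x => abs_le.1 (hb x)) ⟨0, by simpa using hc⟩ hT
  have hh : ∀ x, |h x| ≤ c := fun x => abs_le.2 (hmem x)
  have hoff : HasDBound (f - ⇑h) (2 * c) := by
    refine .of_continuousAt_off_closed hT ⟨x₀, mem_insert _ _⟩ (fun x hx => ?_) (fun x => ?_)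
      fun x hx => ?_
    · have hx' : ContinuousAt f x := by
        by_contra hn
        exact hx (Or.inr hn)
      exact hx'.sub h.continuous.continuousAt
    · exact (abs_sub _ _).trans (by linarith [hb x, hh x])
    · have := DFunLike.congr_fun heq ⟨x, hx⟩
      exact sub_eq_zero.2 this.symm
  have := (HasDBound.of_continuous h.continuous hh).add hoff
  rwa [add_sub_cancel, show c + 2 * c = 3 * c by ring] at this

theorem IsStep.simpleD {f : X → ℝ} (hf : IsStep f) : SimpleD f :=
  let ⟨_, hc⟩ := hf.exists_abs_le
  ⟨(HasDBound.of_finite_discontinuities hf.2 hc).memDBSC, hf.1⟩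

theorem hasDBound_sub_of_isStep_approx {f : X → ℝ} {a : ℕ → X → ℝ} (ha : ∀ n, IsStep (a n))
    (hfa : ∀ n x, |f x - a n x| ≤ (1 / 2) ^ n) (n : ℕ) :
    HasDBound (f - a n) (12 * (1 / 2) ^ n) := by
  have hle : ∀ k x, |a (n + (k + 1)) x - a (n + k) x| ≤ 2 * (1 / 2) ^ n * (1 / 2) ^ k := by
    intro k x
    have h1 := hfa (n + (k + 1)) x
    have h2 := hfa (n + k) x
    have h3 : (1 / 2 : ℝ) ^ (n + (k + 1)) ≤ (1 / 2) ^ (n + k) :=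
      pow_le_pow_of_le_one (by norm_num) (by norm_num) (by omega)
    calc _ ≤ |f x - a (n + k) x| + |f x - a (n + (k + 1)) x| := by
          rw [← sub_sub_sub_cancel_left _ _ (f x)]; exact abs_sub _ _
      _ ≤ 2 * (1 / 2) ^ (n + k) := by linarith
      _ = _ := by rw [pow_add, mul_assoc]
  refine .of_hasSum (s := fun k => a (n + (k + 1)) - a (n + k))
    (c := fun k => 3 * (2 * (1 / 2) ^ n * (1 / 2) ^ k))
    (fun k => .of_finite_discontinuities ((ha _).sub (ha _)).2 (hle k)) ?_ fun x => ?_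
  · rw [show (12 : ℝ) * (1 / 2) ^ n = 3 * (2 * (1 / 2) ^ n * 2) by ring]
    exact (hasSum_geometric_two.mul_left _).mul_left 3
  · refine hasSum_sub_of_tendsto (a := fun k => a (n + k) x) ?_ ?_
    · have h0 : Tendsto (fun k => (1 / 2 : ℝ) ^ k) atTop (𝓝 0) :=
        tendsto_pow_atTop_nhds_zero_of_lt_one (by norm_num) (by norm_num)
      have ht : Tendsto (fun k => a k x) atTop (𝓝 (f x)) := by
        rw [tendsto_iff_norm_sub_tendsto_zero]
        refine squeeze_zero (fun k => norm_nonneg _) (fun k => ?_) h0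
        rw [norm_sub_rev]
        exact hfa k x
      simpa only [add_comm n] using (tendsto_add_atTop_iff_nat n).2 ht
    · exact .of_norm_bounded (summable_geometric_two.mul_left (2 * (1 / 2) ^ n))
        fun k => hle k x

theorem memSD_and_memDBSC_of_isStep_approx [Nonempty X] {f : X → ℝ}
    (h : ∀ ε > 0, ∃ s, IsStep s ∧ ∀ x, |f x - s x| ≤ ε) : MemSD f ∧ MemDBSC f := by
  choose a ha hfa using fun n : ℕ => h ((1 / 2) ^ n) (by positivity)
  have hD := hasDBound_sub_of_isStep_approx ha hfa
  refine ⟨⟨a, fun n => (ha n).simpleD, ?_⟩, ?_⟩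
  · refine squeeze_zero (fun n => dNorm_nonneg _) (fun n => (hD n).dNorm_le) ?_
    simpa using (tendsto_pow_atTop_nhds_zero_of_lt_one (r := (1 / 2 : ℝ)) (by norm_num)
      (by norm_num)).const_mul 12
  · simpa using (hD 0).memDBSC.add (ha 0).simpleD.1

end MetricSpace

theorem isStep_trichotomy {X : Type*} [TopologicalSpace X] [LinearOrder X] [OrderTopology X]
    (x : X) (l m r : ℝ) : IsStep fun y => if y < x then l else if x < y then r else m := by
  refine ⟨(toFinite {l, r, m}).subset ?_, (finite_singleton x).subset ?_⟩
  · rintro _ ⟨y, rfl⟩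
    dsimp only
    split_ifs <;> simp
  · intro y hy
    by_contra hne
    apply hy
    rcases lt_or_gt_of_ne hne with h | h
    · refine (continuousAt_const (y := l)).congr ?_
      filter_upwards [Iio_mem_nhds h] with z hz
      rw [if_pos (mem_Iio.1 hz)]
    · refine (continuousAt_const (y := r)).congr ?_
      filter_upwards [Ioi_mem_nhds h] with z hz
      rw [if_neg (not_lt_of_gt (mem_Ioi.1 hz)), if_pos (mem_Ioi.1 hz)]

theorem finite_frontier_ball_Icc (x : ↥(Icc (0 : ℝ) 1)) (r : ℝ) :
    (frontier (Metric.ball x r)).Finite := by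
  refine Finite.subset ?_ Metric.frontier_ball_subset_sphere
  refine Finite.of_finite_image (f := Subtype.val)
    ((toFinite {(x : ℝ) + r, (x : ℝ) - r}).subset ?_) Subtype.val_injective.injOn
  rintro _ ⟨y, hy, rfl⟩
  rw [Metric.mem_sphere, Subtype.dist_eq, Real.dist_eq] at hy
  rcases abs_choice ((y : ℝ) - x) with h | h
  · left; linarith
  · right; rw [mem_singleton_iff]; linarith

theorem exists_isStep_approx (f : ↥(Icc (0 : ℝ) 1) → ℝ)
    (hlim : ∀ x : ↥(Icc (0 : ℝ) 1),
      (∃ l : ℝ, Tendsto f (𝓝[<] x) (𝓝 l)) ∧ (∃ l : ℝ, Tendsto f (𝓝[>] x) (𝓝 l)))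
    {ε : ℝ} (hε : 0 < ε) : ∃ s, IsStep s ∧ ∀ x, |f x - s x| ≤ ε := by
  classical
  suffices h : ∃ A : Set ↥(Icc (0 : ℝ) 1), univ ⊆ A ∧ (frontier A).Finite ∧
      ∃ s, IsStep s ∧ ∀ x ∈ A, |f x - s x| ≤ ε by
    obtain ⟨A, hA, -, s, hs, h⟩ := h
    exact ⟨s, hs, fun x => h x (hA (mem_univ x))⟩
  refine isCompact_univ.induction_on (p := fun S => ∃ A : Set ↥(Icc (0 : ℝ) 1), S ⊆ A ∧
      (frontier A).Finite ∧ ∃ s, IsStep s ∧ ∀ x ∈ A, |f x - s x| ≤ ε) ?_ ?_ ?_ ?_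
  · exact ⟨∅, Subset.rfl, by simp, _, isStep_trichotomy 0 0 0 0, by simp⟩
  · rintro S S' hSS' ⟨A, hA, h⟩
    exact ⟨A, hSS'.trans hA, h⟩
  · rintro S S' ⟨A, hSA, hA, s, hs, h⟩ ⟨A', hSA', hA', s', hs', h'⟩
    refine ⟨A ∪ A', union_subset_union hSA hSA', ?_, A.piecewise s s', hs.piecewise hs' hA, ?_⟩
    · exact (hA.union hA').subset ((frontier_union_subset _ _).trans
        (union_subset_union inter_subset_left inter_subset_right))
    · intro x hx
      by_cases hxA : x ∈ A
      · rw [piecewise_eq_of_mem _ _ _ hxA]; exact h x hxA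
      · rw [piecewise_eq_of_notMem _ _ _ hxA]; exact h' x (hx.resolve_left hxA)
  · intro x _
    obtain ⟨⟨l, hl⟩, ⟨r, hr⟩⟩ := hlim x
    have hl' := eventually_nhdsWithin_iff.1 (hl.eventually (Metric.closedBall_mem_nhds l hε))
    have hr' := eventually_nhdsWithin_iff.1 (hr.eventually (Metric.closedBall_mem_nhds r hε))
    obtain ⟨δ, hδ, hball⟩ := Metric.eventually_nhds_iff_ball.1 (hl'.and hr')
    refine ⟨Metric.ball x δ, mem_nhdsWithin_of_mem_nhds (Metric.ball_mem_nhds x hδ),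
      Metric.ball x δ, Subset.rfl, finite_frontier_ball_Icc x δ, _,
      isStep_trichotomy x l (f x) r, fun y hy => ?_⟩
    split_ifs with h1 h2
    · exact (hball y hy).1 h1
    · exact (hball y hy).2 h2
    · rw [le_antisymm (not_lt.1 h2) (not_lt.1 h1), sub_self, abs_zero]
      exact hε.le

/-- A bounded function on `[0,1]` with one-sided limits everywhere is a strong
D-function; in particular it is a difference of bounded semicontinuous functions. -/
theorem memSD_of_one_sided_limits (f : ↥(Set.Icc (0 : ℝ) 1) → ℝ) (hb : BddFun f)
    (hlim : ∀ x : ↥(Set.Icc (0 : ℝ) 1),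
      (∃ l : ℝ, Tendsto f (𝓝[<] x) (𝓝 l)) ∧ (∃ l : ℝ, Tendsto f (𝓝[>] x) (𝓝 l))) :
    MemSD f ∧ MemDBSC f :=
  memSD_and_memDBSC_of_isStep_approx fun _ hε => exists_isStep_approx f hlim hε
end
end

section
/- Let K be a separable metric space, ε > 0, and f : K → ℝ a bounded function with osc f(x) ≤ ε for all x ∈ K. Then there exists a continuous function φ : K → ℝ with |f(x) − φ(x)| ≤ ε for all x ∈ K. -/
open Filter Topology Set

noncomputable section

open scoped ENNReal

section Insertion

variable {X : Type*}

lemma BddFun.bddAbove_image {f : X → ℝ} (hf : BddFun f) (V : Set X) : BddAbove (f '' V) := by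
  obtain ⟨C, hC⟩ := hf
  exact ⟨C, by rintro _ ⟨y, -, rfl⟩; exact (abs_le.1 (hC y)).2⟩

lemma BddFun.neg {f : X → ℝ} (hf : BddFun f) : BddFun (-f) := by
  obtain ⟨C, hC⟩ := hf
  exact ⟨C, fun x => by simpa using hC x⟩

lemma BddFun.abs_sub_const {f : X → ℝ} (hf : BddFun f) (a : ℝ) : BddFun fun y => |f y - a| := by
  obtain ⟨C, hC⟩ := hf
  refine ⟨C + |a|, fun x => ?_⟩
  rw [abs_abs]
  linarith [abs_sub (f x) a, hC x]

variable [TopologicalSpace X]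

lemma losc_eq_uEnv (f : X → ℝ) (x : X) : losc f x = uEnv (fun y => |f y - f x|) x := rfl

lemma uEnv_le_of_forall_le {f : X → ℝ} (hf : BddFun f) {x : X} {V : Set X} (hV : IsOpen V)
    (hx : x ∈ V) {c : ℝ} (hc : ∀ y ∈ V, f y ≤ c) : uEnv f x ≤ c := by
  have hsup : sSup (f '' V) ≤ c :=
    csSup_le ⟨f x, x, hx, rfl⟩ (by rintro _ ⟨y, hy, rfl⟩; exact hc y hy)
  unfold uEnv
  refine csInf_le_of_le ⟨f x, ?_⟩ ⟨V, hV, hx, rfl⟩ hsup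
  rintro _ ⟨W, -, hxW, rfl⟩
  exact le_csSup (hf.bddAbove_image W) ⟨x, hxW, rfl⟩

lemma exists_isOpen_of_uEnv_lt {f : X → ℝ} (hf : BddFun f) {x : X} {c : ℝ} (hc : uEnv f x < c) :
    ∃ V, IsOpen V ∧ x ∈ V ∧ ∃ b < c, ∀ y ∈ V, f y ≤ b := by
  unfold uEnv at hc
  obtain ⟨_, ⟨V, hV, hx, rfl⟩, hlt⟩ :=
    exists_lt_of_csInf_lt (by exact ⟨_, Set.univ, isOpen_univ, mem_univ x, rfl⟩) hc
  exact ⟨V, hV, hx, _, hlt, fun y hy => le_csSup (hf.bddAbove_image V) ⟨y, hy, rfl⟩⟩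

lemma le_uEnv {f : X → ℝ} (hf : BddFun f) (x : X) : f x ≤ uEnv f x := by
  by_contra! h
  obtain ⟨V, -, hx, b, hb, hV⟩ := exists_isOpen_of_uEnv_lt hf h
  exact (hV x hx).not_gt hb

lemma upperSemicontinuous_uEnv {f : X → ℝ} (hf : BddFun f) : UpperSemicontinuous (uEnv f) := by
  intro x c hc
  obtain ⟨V, hV, hx, b, hb, hVb⟩ := exists_isOpen_of_uEnv_lt hf hc
  filter_upwards [hV.mem_nhds hx] with y hy
  exact (uEnv_le_of_forall_le hf hV hy hVb).trans_lt hb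

lemma BddFun.losc {f : X → ℝ} (hf : BddFun f) : BddFun (losc f) := by
  obtain ⟨C, hC⟩ := id hf
  refine ⟨C + C, fun x => ?_⟩
  have hbdd := hf.abs_sub_const (f x)
  rw [losc_eq_uEnv, abs_of_nonneg ((abs_nonneg _).trans (le_uEnv hbdd x))]
  exact uEnv_le_of_forall_le hbdd isOpen_univ (mem_univ x) fun y _ =>
    (abs_sub _ _).trans (add_le_add (hC y) (hC x))

lemma losc_neg (f : X → ℝ) : losc (-f) = losc f := by
  ext x
  simp only [losc_eq_uEnv, Pi.neg_apply]
  congr 1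
  ext y
  rw [neg_sub_neg, abs_sub_comm]

lemma uEnv_le_add_losc {f : X → ℝ} (hf : BddFun f) (x : X) : uEnv f x ≤ f x + losc f x := by
  refine le_of_forall_pos_le_add fun η hη => ?_
  obtain ⟨V, hV, hx, b, hb, hVb⟩ := exists_isOpen_of_uEnv_lt (hf.abs_sub_const (f x))
    (show uEnv (fun y => |f y - f x|) x < losc f x + η from lt_add_of_pos_right _ hη)
  refine uEnv_le_of_forall_le hf hV hx fun y hy => ?_
  linarith [hVb y hy, le_abs_self (f y - f x)]

lemma exists_continuous_between_add [NormalSpace X] [ParacompactSpace X] {g h : X → ℝ}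
    (hg : UpperSemicontinuous g) (hh : LowerSemicontinuous h) (hgh : ∀ x, g x ≤ h x)
    {δ : ℝ} (hδ : 0 < δ) :
    ∃ φ : C(X, ℝ), ∀ x, g x - δ < φ x ∧ φ x < h x + δ := by
  refine exists_continuous_forall_mem_convex_of_local_const
    (t := fun x => Ioo (g x - δ) (h x + δ)) (fun x => convex_Ioo _ _) fun x => ⟨g x, ?_⟩
  filter_upwards [hg x (g x + δ) (by linarith), hh x (g x - δ) (by linarith [hgh x])] with y h₁ h₂
  exact ⟨by linarith, by linarith⟩

lemma exists_continuous_between_refine [NormalSpace X] [ParacompactSpace X] {g h : X → ℝ}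
    (hg : UpperSemicontinuous g) (hh : LowerSemicontinuous h) (hgh : ∀ x, g x ≤ h x)
    {δ : ℝ} (hδ : 0 < δ) (φ : C(X, ℝ)) (hφ : ∀ x, g x - δ < φ x ∧ φ x < h x + δ) :
    ∃ ψ : C(X, ℝ), (∀ x, g x - δ / 2 < ψ x ∧ ψ x < h x + δ / 2) ∧
      ∀ x, |ψ x - φ x| ≤ 3 / 2 * δ := by
  obtain ⟨ψ, hψ⟩ := exists_continuous_between_add
    (hg.sup (f := g) (g := fun x => φ x - δ)
      (φ.continuous.sub continuous_const).upperSemicontinuous)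
    (hh.inf (f := h) (g := fun x => φ x + δ)
      (φ.continuous.add continuous_const).lowerSemicontinuous)
    (fun x => sup_le (le_inf (hgh x) (by linarith [hφ x]))
      (le_inf (by linarith [hφ x]) (by linarith))) (half_pos hδ)
  refine ⟨ψ, fun x => ⟨?_, ?_⟩, fun x => abs_le.2 ⟨?_, ?_⟩⟩ <;> obtain ⟨h₁, h₂⟩ := hψ x
  · linarith [le_max_left (g x) (φ x - δ)]
  · linarith [min_le_left (h x) (φ x + δ)]
  · linarith [le_max_right (g x) (φ x - δ)]
  · linarith [min_le_right (h x) (φ x + δ)]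

/-- The Hahn–Katětov–Tong insertion theorem on normal paracompact spaces. -/
theorem exists_continuous_between [NormalSpace X] [ParacompactSpace X] {g h : X → ℝ}
    (hg : UpperSemicontinuous g) (hh : LowerSemicontinuous h) (hgh : ∀ x, g x ≤ h x) :
    ∃ φ : X → ℝ, Continuous φ ∧ ∀ x, g x ≤ φ x ∧ φ x ≤ h x := by
  let P (n : ℕ) := {φ : C(X, ℝ) // ∀ x, g x - (1 / 2) ^ n < φ x ∧ φ x < h x + (1 / 2) ^ n}
  have step (n : ℕ) (φ : P n) : ∃ ψ : P (n + 1), ∀ x, |ψ.1 x - φ.1 x| ≤ 3 / 2 * (1 / 2) ^ n := by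
    obtain ⟨ψ, h₁, h₂⟩ :=
      exists_continuous_between_refine hg hh hgh (by positivity) φ.1 φ.2
    exact ⟨⟨ψ, fun x => by simpa [pow_succ, div_eq_mul_inv] using h₁ x⟩, h₂⟩
  choose next hnext using step
  obtain ⟨φ₀, hφ₀⟩ := exists_continuous_between_add hg hh hgh one_pos
  let φ (n : ℕ) : P n := Nat.rec ⟨φ₀, by simpa using hφ₀⟩ next n
  have hφ (n : ℕ) (x : X) : ‖(φ (n + 1)).1 x - (φ n).1 x‖ ≤ 3 / 2 * (1 / 2) ^ n := hnext n (φ n) x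
  have hsum : Summable fun n : ℕ => (3 / 2 : ℝ) * (1 / 2) ^ n := summable_geometric_two.mul_left _
  have hlim (x : X) : Tendsto (fun n => (φ n).1 x) atTop
      (𝓝 (∑' n, ((φ (n + 1)).1 x - (φ n).1 x) + (φ 0).1 x)) := by
    have := (Summable.of_norm_bounded hsum fun n => hφ n x).hasSum.tendsto_sum_nat
    simpa [Finset.sum_range_sub (fun n => (φ n).1 x)] using this.add_const ((φ 0).1 x)
  have hpow : Tendsto (fun n : ℕ => (1 / 2 : ℝ) ^ n) atTop (𝓝 0) :=
    tendsto_pow_atTop_nhds_zero_of_lt_one (by norm_num) (by norm_num)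
  refine ⟨fun x => ∑' n, ((φ (n + 1)).1 x - (φ n).1 x) + (φ 0).1 x, ?_, fun x => ⟨?_, ?_⟩⟩
  · exact (continuous_tsum (fun n => (φ (n + 1)).1.continuous.sub (φ n).1.continuous) hsum hφ).add
      (φ 0).1.continuous
  · exact le_of_tendsto_of_tendsto' (by simpa using hpow.const_sub (g x)) (hlim x)
      fun n => ((φ n).2 x).1.le
  · exact le_of_tendsto_of_tendsto' (hlim x) (by simpa using hpow.const_add (h x))
      fun n => ((φ n).2 x).2.le

end Insertion

/-- **Lemma 2.5.** If `osc f ≤ ε` everywhere, then `f` is uniformly within `ε`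
of a continuous function. -/
theorem exists_continuous_approx_of_osc_le {K : Type*} [MetricSpace K]
    [TopologicalSpace.SeparableSpace K] (ε : ℝ) (hε : 0 < ε) (f : K → ℝ)
    (hb : BddFun f) (hosc : ∀ x, osc f x ≤ ε) :
    ∃ φ : K → ℝ, Continuous φ ∧ ∀ x, |f x - φ x| ≤ ε := by
  have hlosc (x : K) : losc f x ≤ ε := (le_uEnv hb.losc x).trans (hosc x)
  have hupper (x : K) : uEnv f x - ε ≤ f x := by linarith [uEnv_le_add_losc hb x, hlosc x]
  have hlower (x : K) : f x ≤ -uEnv (-f) x + ε := by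
    have := uEnv_le_add_losc hb.neg x
    rw [losc_neg, Pi.neg_apply] at this
    linarith [hlosc x]
  obtain ⟨φ, hφc, hφ⟩ := exists_continuous_between
    (g := fun x => uEnv f x - ε) (h := fun x => -uEnv (-f) x + ε)
    (fun x c hc => by
      filter_upwards [upperSemicontinuous_uEnv hb x (c + ε) (by linarith)] with y hy
      linarith)
    (fun x c hc => by
      filter_upwards [upperSemicontinuous_uEnv hb.neg x (ε - c) (by linarith)] with y hy
      linarith)
    fun x => (hupper x).trans (hlower x)
  refine ⟨φ, hφc, fun x => abs_le.2 ⟨?_, ?_⟩⟩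
  · have := le_uEnv hb.neg x
    rw [Pi.neg_apply] at this
    linarith [(hφ x).2]
  · linarith [(hφ x).1, le_uEnv hb x]
end
end

section
/- Let K be a separable metric space, n ≥ 1, and let K = K_0 ⊃ K_1 ⊃ ⋯ ⊃ K_n be closed non-empty sets with K_i nowhere dense relative to K_{i−1} for all 1 ≤ i ≤ n, and set K_{n+1} = ∅. Let E = ⋃_{0≤i≤⌊n/2⌋} (K_{2i} \ K_{2i+1}). Then i(χ_E, ε) = n for all 0 < ε ≤ 1, the Baire index i(χ_E) = n, and ‖χ_E‖_D ≤ n + 1. -/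
open Filter Topology Set

noncomputable section

open scoped ENNReal

theorem sSup_abs_sub_image_nonneg {X : Type*} (f : X → ℝ) (x : X) (V : Set X) :
    0 ≤ sSup ((fun y => |f y - f x|) '' V) :=
  Real.sSup_nonneg (by rintro _ ⟨y, -, rfl⟩; exact abs_nonneg _)

section Oscillation

variable {X : Type*} [TopologicalSpace X] {f : X → ℝ} {x : X}

theorem losc_nonneg (f : X → ℝ) (x : X) : 0 ≤ losc f x :=
  Real.sInf_nonneg (by rintro _ ⟨V, -, -, rfl⟩; exact sSup_abs_sub_image_nonneg f x V)

theorem losc_le {V : Set X} (hV : IsOpen V) (hx : x ∈ V) {c : ℝ} (hc : 0 ≤ c)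
    (h : ∀ y ∈ V, |f y - f x| ≤ c) : losc f x ≤ c := by
  refine csInf_le_of_le ⟨0, ?_⟩ ⟨V, hV, hx, rfl⟩ (Real.sSup_le ?_ hc)
  · rintro _ ⟨W, -, -, rfl⟩
    exact sSup_abs_sub_image_nonneg f x W
  · rintro _ ⟨y, hy, rfl⟩
    exact h y hy

theorem osc_le {V : Set X} (hV : IsOpen V) (hx : x ∈ V) {c : ℝ} (hc : 0 ≤ c)
    (h : ∀ y ∈ V, ∀ z ∈ V, |f z - f y| ≤ c) : osc f x ≤ c := by
  refine csInf_le_of_le ⟨0, ?_⟩ ⟨V, hV, hx, rfl⟩ (Real.sSup_le ?_ hc)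
  · rintro _ ⟨W, -, -, rfl⟩
    exact Real.sSup_nonneg (by rintro _ ⟨y, -, rfl⟩; exact losc_nonneg f y)
  · rintro _ ⟨y, hy, rfl⟩
    exact losc_le hV hy hc (h y hy)

theorem le_losc {C : ℝ} (hC : ∀ y z, |f z - f y| ≤ C) {c : ℝ}
    (h : ∀ V, IsOpen V → x ∈ V → ∃ y ∈ V, c ≤ |f y - f x|) : c ≤ losc f x := by
  refine le_csInf ⟨_, univ, isOpen_univ, mem_univ x, rfl⟩ ?_
  rintro _ ⟨V, hV, hx, rfl⟩
  obtain ⟨y, hy, hcy⟩ := h V hV hx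
  refine hcy.trans (le_csSup ⟨C, ?_⟩ ⟨y, hy, rfl⟩)
  rintro _ ⟨z, -, rfl⟩
  exact hC x z

theorem le_osc {C : ℝ} (hC : ∀ y z, |f z - f y| ≤ C) {c : ℝ}
    (h : ∀ V, IsOpen V → x ∈ V →
      ∃ y ∈ V, ∀ W, IsOpen W → y ∈ W → ∃ z ∈ W, c ≤ |f z - f y|) : c ≤ osc f x := by
  refine le_csInf ⟨_, univ, isOpen_univ, mem_univ x, rfl⟩ ?_
  rintro _ ⟨V, hV, hx, rfl⟩
  obtain ⟨y, hy, hcy⟩ := h V hV hx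
  refine (le_losc hC hcy).trans (le_csSup ⟨C, ?_⟩ ⟨y, hy, rfl⟩)
  rintro _ ⟨z, -, rfl⟩
  exact losc_le isOpen_univ (mem_univ z) ((abs_nonneg _).trans (hC z z)) fun w _ => hC z w

theorem osSet_antitone (f : X → ℝ) (ε : ℝ) : Antitone (osSet f ε) :=
  antitone_nat_of_succ_le fun _ _ h => h.1

theorem osSet_one_eq_empty {C ε : ℝ} (hC : ∀ y z, |f z - f y| ≤ C) (hε : C < ε) :
    osSet f ε 1 = ∅ := by
  refine eq_empty_of_forall_notMem ?_
  rintro x ⟨h, hx⟩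
  exact absurd (hx.trans (osc_le isOpen_univ (mem_univ _) ((abs_nonneg _).trans (hC x x))
    fun y _ z _ => hC y z)) (not_le.2 hε)

theorem oscIndex_le {ε : ℝ} {m : ℕ} (h : osSet f ε (m + 1) = ∅) : oscIndex f ε ≤ m := by
  refine iSup₂_le fun k hk => ?_
  by_contra hlt
  have hle : m + 1 ≤ k := by exact_mod_cast not_le.1 hlt
  exact (hk.mono (osSet_antitone f ε hle)).ne_empty h

theorem le_oscIndex {ε : ℝ} {m : ℕ} (h : (osSet f ε m).Nonempty) : (m : ℕ∞) ≤ oscIndex f ε :=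
  le_iSup₂ (f := fun (k : ℕ) (_ : (osSet f ε k).Nonempty) => (k : ℕ∞)) m h

end Oscillation

theorem exists_hasSum_indicator_compl {X : Type*} [PseudoMetricSpace X] {F : Set X}
    (hF : IsClosed F) (hne : F.Nonempty) :
    ∃ ψ : ℕ → X → ℝ, (∀ k, Continuous (ψ k)) ∧ (∀ k x, 0 ≤ ψ k x) ∧
      ∀ x, HasSum (fun k => ψ k x) (Fᶜ.indicator (fun _ => 1) x) := by
  set h : ℕ → X → ℝ := fun k x => min 1 (k * Metric.infDist x F) with hh
  have hnonneg : ∀ k x, 0 ≤ h (k + 1) x - h k x := fun k x => by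
    refine sub_nonneg.2 (min_le_min le_rfl ?_)
    gcongr
    · exact Metric.infDist_nonneg
    · simp
  refine ⟨fun k x => h (k + 1) x - h k x, fun k => ?_, hnonneg, fun x => ?_⟩
  · simp only [hh]
    fun_prop
  · refine (hasSum_iff_tendsto_nat_of_nonneg (hnonneg · x) _).2 ?_
    simp only [Finset.sum_range_sub (fun k => h k x)]
    have hzero : h 0 x = 0 := by simp [hh]
    rw [hzero]
    simp only [sub_zero, hh]
    by_cases hx : x ∈ F
    · simp [hx, Metric.infDist_zero_of_mem hx]
    · have hpos : 0 < Metric.infDist x F := (hF.notMem_iff_infDist_pos hne).1 hx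
      have hlim : Tendsto (fun k : ℕ => (k : ℝ) * Metric.infDist x F) atTop atTop :=
        tendsto_natCast_atTop_atTop.atTop_mul_const hpos
      rw [indicator_of_mem (by exact hx)]
      refine tendsto_const_nhds.congr' ?_
      filter_upwards [hlim.eventually_ge_atTop 1] with k hk
      exact (min_eq_left hk).symm

theorem indicator_one_sub_abs_le {X : Type*} (E : Set X) (y z : X) :
    |E.indicator (fun _ => (1 : ℝ)) z - E.indicator (fun _ => (1 : ℝ)) y| ≤ 1 := by
  by_cases hy : y ∈ E <;> by_cases hz : z ∈ E <;> simp [hy, hz]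

/-- Each point of the space belongs to exactly the members `Kc 0, …, Kc j` of a decreasing chain
for some `j`. -/
theorem exists_mem_chain_iff_le {X : Type*} {n : ℕ} {Kc : ℕ → Set X} (h0 : Kc 0 = univ)
    (hchain : ∀ i < n, Kc (i + 1) ⊆ Kc i) (htop : Kc (n + 1) = ∅) (x : X) :
    ∃ j ≤ n, ∀ i ≤ n + 1, x ∈ Kc i ↔ i ≤ j := by
  classical
  have hex : ∃ i, x ∉ Kc i := ⟨n + 1, by simp [htop]⟩
  have hpos : Nat.find hex ≠ 0 := fun h => Nat.find_spec hex (by simp [h, h0])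
  have hle : Nat.find hex ≤ n + 1 := Nat.find_min' hex (by simp [htop])
  have hanti : ∀ i ≤ n + 1, Nat.find hex ≤ i → x ∉ Kc i := by
    intro i hi hfi
    induction i, hfi using Nat.le_induction with
    | base => exact Nat.find_spec hex
    | succ i _ ih =>
      rcases Nat.lt_or_ge i n with hin | hin
      · exact fun hx => ih (by omega) (hchain i hin hx)
      · obtain rfl : i = n := by omega
        simp [htop]
  refine ⟨Nat.find hex - 1, by omega, fun i hi => ⟨fun hx => ?_, fun hij => ?_⟩⟩
  · by_contra hlt
    exact hanti i hi (by omega) hx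
  · exact not_not.1 (Nat.find_min hex (by omega))

theorem mem_iUnion_even_diff_iff {X : Type*} {n j : ℕ} {Kc : ℕ → Set X} {x : X} (hj : j ≤ n)
    (hx : ∀ i ≤ n + 1, x ∈ Kc i ↔ i ≤ j) :
    x ∈ ⋃ i ∈ Finset.range (n / 2 + 1), Kc (2 * i) \ Kc (2 * i + 1) ↔ Even j := by
  simp only [mem_iUnion, Finset.mem_range, Set.mem_sdiff, exists_prop]
  constructor
  · rintro ⟨i, hi, h1, h2⟩
    rw [hx _ (by omega)] at h1 h2
    exact ⟨i, by omega⟩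
  · rintro ⟨i, rfl⟩
    refine ⟨i, by omega, ?_, ?_⟩ <;> rw [hx _ (by omega)] <;> omega

theorem inter_diff_nonempty_of_isNowhereDense {X : Type*} [TopologicalSpace X] {A B : Set X}
    (hAB : IsNowhereDense {x : ↥A | (x : X) ∈ B}) {U : Set X} (hU : IsOpen U)
    (hUA : (U ∩ A).Nonempty) : (U ∩ (A \ B)).Nonempty := by
  obtain ⟨x, hxU, hxA⟩ := hUA
  have hdense : Dense {x : ↥A | (x : X) ∈ B}ᶜ := by
    refine interior_eq_empty_iff_dense_compl.1 (subset_empty_iff.1 ?_)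
    exact (interior_mono subset_closure).trans (subset_empty_iff.2 hAB)
  obtain ⟨y, hyU, hyB⟩ :=
    hdense.inter_open_nonempty _ (hU.preimage continuous_subtype_val) ⟨⟨x, hxA⟩, hxU⟩
  exact ⟨y, hyU, y.2, hyB⟩

/-- One step of the oscillation derivation: if `f` is constant on `A \ B`, dense in `A`, and takes a
constant value at distance at least `1` on `B \ C`, dense in the closed set `B`, then the points of
`A` at which the restriction of `f` to `A` oscillates by at least `ε ≤ 1` are those of `B`. -/
theorem setOf_le_osc_restrict_eq {X : Type*} [TopologicalSpace X] {f : X → ℝ} {A B C : Set X}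
    {ε a b : ℝ} (hε : 0 < ε) (hε1 : ε ≤ 1) (hf : ∀ y z, |f z - f y| ≤ 1) (hB : IsClosed B)
    (hBA : B ⊆ A) (ha : ∀ x ∈ A \ B, f x = a) (hb : ∀ x ∈ B \ C, f x = b) (hab : 1 ≤ |a - b|)
    (hAB : ∀ U, IsOpen U → (U ∩ A).Nonempty → (U ∩ (A \ B)).Nonempty)
    (hBC : ∀ U, IsOpen U → (U ∩ B).Nonempty → (U ∩ (B \ C)).Nonempty) :
    {x | ∃ h : x ∈ A, ε ≤ osc (fun y : A => f y) ⟨x, h⟩} = B := by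
  ext x
  constructor
  · rintro ⟨hxA, hx⟩
    by_contra hxB
    refine absurd (hx.trans (osc_le (hB.isOpen_compl.preimage continuous_subtype_val) hxB le_rfl
      fun y hy z hz => ?_)) (not_le.2 hε)
    simp [ha y ⟨y.2, hy⟩, ha z ⟨z.2, hz⟩]
  · intro hxB
    refine ⟨hBA hxB, hε1.trans (le_osc (fun y z : A => hf y z) fun V hV hxV => ?_)⟩
    obtain ⟨U, hU, rfl⟩ := isOpen_induced_iff.1 hV
    obtain ⟨y, hyU, hy⟩ := hBC U hU ⟨x, hxV, hxB⟩
    refine ⟨⟨y, hBA hy.1⟩, hyU, fun W hW hyW => ?_⟩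
    obtain ⟨O, hO, rfl⟩ := isOpen_induced_iff.1 hW
    obtain ⟨z, hzO, hz⟩ := hAB O hO ⟨y, hyW, hBA hy.1⟩
    refine ⟨⟨z, hz.1⟩, hzO, ?_⟩
    simpa [ha z hz, hb y hy] using hab

theorem osSet_succ {X : Type*} [TopologicalSpace X] {f : X → ℝ} {ε : ℝ} {m : ℕ} {L : Set X}
    (h : osSet f ε m = L) :
    osSet f ε (m + 1) = {x | ∃ h : x ∈ L, ε ≤ osc (fun y : L => f y) ⟨x, h⟩} := by
  subst h
  rfl

theorem dNorm_le {X : Type*} [TopologicalSpace X] [Nonempty X] {f : X → ℝ} {c : ℝ}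
    (φ : ℕ → X → ℝ) (hφ : ∀ j, Continuous (φ j)) (hs : ∀ x, Summable fun j => |φ j x|)
    (hf : ∀ x, ∑' j, φ j x = f x) (hc : ∀ x, ∑' j, |φ j x| ≤ c) : DNorm f ≤ c := by
  refine csInf_le ⟨0, ?_⟩ ⟨φ, hφ, hs, hf, hc⟩
  rintro d ⟨ψ, -, -, -, hd⟩
  exact (tsum_nonneg fun _ => abs_nonneg _).trans (hd (Classical.arbitrary X))

/-- The D-norm of an alternating sum of `n + 1` indicators of nonempty closed sets, the first of
them the whole space, is at most `n + 1`. -/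
theorem dNorm_alternating_sum_le {X : Type*} [PseudoMetricSpace X] [Nonempty X] {n : ℕ}
    {F : ℕ → Set X} (h0 : F 0 = univ) (hclosed : ∀ i ≤ n, IsClosed (F i))
    (hne : ∀ i ≤ n, (F i).Nonempty) :
    DNorm (fun x => ∑ i ∈ Finset.range (n + 1), (-1) ^ i * (F i).indicator (fun _ => (1 : ℝ)) x)
      ≤ n + 1 := by
  have hex : ∀ i, ∃ ψ : ℕ → X → ℝ, i ≤ n → (∀ k, Continuous (ψ k)) ∧ (∀ k x, 0 ≤ ψ k x) ∧
      ∀ x, HasSum (fun k => ψ k x) ((F i)ᶜ.indicator (fun _ => 1) x) := fun i => by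
    by_cases hi : i ≤ n
    · obtain ⟨ψ, hψ⟩ := exists_hasSum_indicator_compl (hclosed i hi) (hne i hi)
      exact ⟨ψ, fun _ => hψ⟩
    · exact ⟨0, fun h => absurd h hi⟩
  choose ψ hψ using hex
  have hmem : ∀ i ∈ Finset.range (n + 1), i ≤ n := fun i hi => by
    simpa [Nat.lt_succ_iff] using hi
  set c : ℝ := ∑ i ∈ Finset.range (n + 1), (-1) ^ i with hc
  have hc1 : |c| ≤ 1 := by
    rw [hc, neg_one_geom_sum]
    split_ifs <;> simp
  set φ : ℕ → X → ℝ := fun k x =>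
    (if k = 0 then c else 0) - ∑ i ∈ Finset.range (n + 1), (-1) ^ i * ψ i k x with hφ
  have hsum : ∀ x, HasSum (fun k => φ k x)
      (c - ∑ i ∈ Finset.range (n + 1), (-1) ^ i * (F i)ᶜ.indicator (fun _ => 1) x) := fun x =>
    (hasSum_ite_eq 0 c).sub
      (hasSum_sum fun i hi => ((hψ i (hmem i hi)).2.2 x).mul_left _)
  have hdom : ∀ x, HasSum
      (fun k => (if k = 0 then |c| else 0) + ∑ i ∈ Finset.range (n + 1), ψ i k x)
      (|c| + ∑ i ∈ Finset.range (n + 1), (F i)ᶜ.indicator (fun _ => 1) x) := fun x =>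
    (hasSum_ite_eq 0 |c|).add (hasSum_sum fun i hi => (hψ i (hmem i hi)).2.2 x)
  have hle : ∀ x k, |φ k x| ≤
      (if k = 0 then |c| else 0) + ∑ i ∈ Finset.range (n + 1), ψ i k x := fun x k => by
    refine (abs_sub _ _).trans (add_le_add (by split_ifs <;> simp) ?_)
    refine (Finset.abs_sum_le_sum_abs _ _).trans (Finset.sum_le_sum fun i hi => ?_)
    simp [abs_mul, abs_of_nonneg ((hψ i (hmem i hi)).2.1 k x)]
  have habs : ∀ x, Summable fun k => |φ k x| := fun x =>
    (hdom x).summable.of_nonneg_of_le (fun _ => abs_nonneg _) (hle x)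
  refine dNorm_le φ (fun k => ?_) habs (fun x => ?_) fun x => ?_
  · exact continuous_const.sub (continuous_finsetSum _ fun i hi =>
      continuous_const.mul ((hψ i (hmem i hi)).1 k))
  · rw [(hsum x).tsum_eq, hc, ← Finset.sum_sub_distrib]
    refine Finset.sum_congr rfl fun i _ => ?_
    by_cases hx : x ∈ F i <;> simp [hx]
  · refine ((habs x).tsum_le_tsum (hle x) (hdom x).summable).trans ?_
    rw [(hdom x).tsum_eq, Finset.sum_range_succ', h0]
    have hbound : ∑ i ∈ Finset.range n, (F (i + 1))ᶜ.indicator (fun _ => (1 : ℝ)) x ≤ n := by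
      refine (Finset.sum_le_card_nsmul _ _ 1 fun i _ => ?_).trans (by simp)
      exact indicator_le_self' (fun _ _ => zero_le_one) x
    simp only [compl_univ, indicator_empty, add_zero]
    linarith

/-- **Lemma 2.10.** For a decreasing chain of closed sets, each nowhere dense in
the previous one, the indicator of the union of the even-odd differences has
`ε`-oscillation index `n` for `0 < ε ≤ 1`, Baire index `n`, and D-norm at most
`n + 1`. -/
theorem indicator_index_of_nowhere_dense_chain {K : Type*} [MetricSpace K]
    [TopologicalSpace.SeparableSpace K] (n : ℕ) (hn : 1 ≤ n) (Kc : ℕ → Set K)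
    (h0 : Kc 0 = Set.univ)
    (hclosed : ∀ i ≤ n, IsClosed (Kc i))
    (hne : ∀ i ≤ n, (Kc i).Nonempty)
    (hchain : ∀ i < n, Kc (i + 1) ⊆ Kc i)
    (hnwd : ∀ i < n, IsNowhereDense {x : ↥(Kc i) | (x : K) ∈ Kc (i + 1)})
    (htop : Kc (n + 1) = ∅)
    (E : Set K) (hE : E = ⋃ i ∈ Finset.range (n / 2 + 1), Kc (2 * i) \ Kc (2 * i + 1)) :
    (∀ ε : ℝ, 0 < ε → ε ≤ 1 →
        oscIndex (E.indicator fun _ => (1 : ℝ)) ε = (n : ℕ∞)) ∧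
    baireIndex (E.indicator fun _ => (1 : ℝ)) = (n : ℕ∞) ∧
    DNorm (E.indicator fun _ => (1 : ℝ)) ≤ n + 1 := by
  subst hE
  set E := ⋃ i ∈ Finset.range (n / 2 + 1), Kc (2 * i) \ Kc (2 * i + 1)
  set f : K → ℝ := E.indicator fun _ => (1 : ℝ) with hf
  have hf1 : ∀ y z, |f z - f y| ≤ 1 := indicator_one_sub_abs_le E
  have hrank := exists_mem_chain_iff_le h0 hchain htop
  have hval : ∀ m ≤ n, ∀ x ∈ Kc m \ Kc (m + 1), f x = if Even m then 1 else 0 := by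
    rintro m hm x ⟨h1, h2⟩
    obtain ⟨j, hj, hx⟩ := hrank x
    rw [hx _ (by omega)] at h1 h2
    obtain rfl : m = j := by omega
    classical
    rw [hf, indicator_apply]
    exact if_congr (mem_iUnion_even_diff_iff hj hx) rfl rfl
  have hdense : ∀ m ≤ n, ∀ U, IsOpen U → (U ∩ Kc m).Nonempty →
      (U ∩ (Kc m \ Kc (m + 1))).Nonempty := by
    intro m hm U hU hUm
    rcases hm.lt_or_eq with hlt | rfl
    · exact inter_diff_nonempty_of_isNowhereDense (hnwd m hlt) hU hUm
    · simpa [htop] using hUm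
  have hos : ∀ ε : ℝ, 0 < ε → ε ≤ 1 → ∀ m ≤ n, osSet f ε m = Kc m := by
    intro ε hε hε1 m
    induction m with
    | zero => exact fun _ => h0.symm
    | succ m ih =>
      intro hm
      rw [osSet_succ (ih (by omega))]
      refine setOf_le_osc_restrict_eq hε hε1 hf1 (hclosed _ hm) (hchain m hm)
        (hval m (by omega)) (hval _ hm) ?_ (hdense m (by omega)) (hdense _ hm)
      by_cases hev : Even m <;> simp [Nat.even_add_one, hev]
  have hos_top : ∀ ε : ℝ, 0 < ε → ε ≤ 1 → osSet f ε (n + 1) = ∅ := by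
    intro ε hε hε1
    rw [osSet_succ (hos ε hε hε1 n le_rfl)]
    refine eq_empty_of_forall_notMem ?_
    rintro x ⟨h, hx⟩
    refine absurd (hx.trans (osc_le isOpen_univ (mem_univ _) le_rfl fun y _ z _ => ?_))
      (not_le.2 hε)
    simp [hval n le_rfl y ⟨y.2, by simp [htop]⟩, hval n le_rfl z ⟨z.2, by simp [htop]⟩]
  have hindex : ∀ ε : ℝ, 0 < ε → ε ≤ 1 → oscIndex f ε = (n : ℕ∞) := fun ε hε hε1 =>
    (oscIndex_le (hos_top ε hε hε1)).antisymm
      (le_oscIndex (by rw [hos ε hε hε1 n le_rfl]; exact hne n le_rfl))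
  refine ⟨hindex, le_antisymm (iSup₂_le fun ε hε => ?_) ?_, ?_⟩
  · rcases le_or_gt ε 1 with hε1 | hε1
    · exact (hindex ε hε hε1).le
    · exact (oscIndex_le (m := 0) (osSet_one_eq_empty hf1 hε1)).trans (by simp)
  · exact (hindex 1 one_pos le_rfl).ge.trans
      (le_iSup₂ (f := fun (ε : ℝ) (_ : 0 < ε) => oscIndex f ε) 1 one_pos)
  · have : Nonempty K := (hne 0 (Nat.zero_le n)).to_type
    have hfsum : f = fun x => ∑ i ∈ Finset.range (n + 1),
        (-1) ^ i * (Kc i).indicator (fun _ => (1 : ℝ)) x := by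
      funext x
      obtain ⟨j, hj, hx⟩ := hrank x
      have hfx : f x = if Even j then 1 else 0 :=
        hval j hj x ⟨(hx j (by omega)).2 le_rfl, fun h => by
          have := (hx (j + 1) (by omega)).1 h
          omega⟩
      have hterm : ∀ i ∈ Finset.range (n + 1),
          (-1) ^ i * (Kc i).indicator (fun _ => (1 : ℝ)) x = if i < j + 1 then (-1) ^ i else 0 := by
        intro i hi
        have := hx i (Finset.mem_range.1 hi).le
        by_cases hij : i ≤ j <;> simp [indicator, this, hij]
      rw [Finset.sum_congr rfl hterm, ← Finset.sum_filter, hfx]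
      have hfilter : {i ∈ Finset.range (n + 1) | i < j + 1} = Finset.range (j + 1) := by
        ext i
        simp only [Finset.mem_filter, Finset.mem_range]
        omega
      rw [hfilter, neg_one_geom_sum]
      by_cases hev : Even j <;> simp [Nat.even_add_one, hev]
    rw [hfsum]
    exact dNorm_alternating_sum_le h0 hclosed hne
end
end
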